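/- arXiv:2306.06695 — 2 statements merged into one kernel-verified Lean document; each statement's English description precedes it below -/
import Mathlib

section
/- For any non-trivial bicolouring of the once-punctured convex m-gon P*_m (m ≥ 2), the complex of permitted arcs is an (m−2)-pseudo-manifold with boundary; concretely: (i) every set of pairwise non-crossing permitted arcs is contained in a set of m−1 pairwise non-crossing permitted arcs; (ii) any two permissible triangulations are joined by a sequence of permissible triangulations in which consecutive ones share exactly m−2 arcs; (iii) every set of m−2 pairwise non-crossing permitted arcs is contained in at most two permissible triangulations. -/
/-!
Vertices of the once-punctured convex `m`-gon `P*_m` are identified with `ZMod m`.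
An arc is an equivalence class `[(a,b)]` of pairs of integers with
`a < b ≤ a + m` and `b - a ≥ 2`, modulo `(a,b) ∼ (a+m, b+m)`.  Each class has a unique
representative with `0 ≤ a < m`; we identify arcs with these canonical representatives,
i.e. with pairs `p : ℤ × ℤ` satisfying `IsPArc m p` below.
Blue is encoded by the Boolean value `true`, red by `false`.
-/

namespace Punc

/-- `p` is (the canonical representative of) an arc of `P*_m`:
`0 ≤ p.1 < m`, `p.1 < p.2 ≤ p.1 + m` and `p.2 - p.1 ≥ 2`. -/
def IsPArc (m : ℕ) (p : ℤ × ℤ) : Prop :=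
  0 ≤ p.1 ∧ p.1 < (m : ℤ) ∧ p.1 + 2 ≤ p.2 ∧ p.2 ≤ p.1 + (m : ℤ)

/-- The arcs `[(a,b)] = p` and `[(c,d)] = q` cross: there is an integer `k` with
`a + km < c < b + km < d` or with `c < a + km < d < b + km`. -/
def PCross (m : ℕ) (p q : ℤ × ℤ) : Prop :=
  ∃ k : ℤ, (p.1 + k * m < q.1 ∧ q.1 < p.2 + k * m ∧ p.2 + k * m < q.2) ∨
    (q.1 < p.1 + k * m ∧ p.1 + k * m < q.2 ∧ q.2 < p.2 + k * m)

/-- The arc `p` is the maximal arc based at `p.1 mod m`, i.e. `p.2 - p.1 = m`. -/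
def IsMaximalArc (m : ℕ) (p : ℤ × ℤ) : Prop :=
  IsPArc m p ∧ p.2 - p.1 = (m : ℤ)

/-- A triangulation of `P*_m`: a set of `m - 1` pairwise non-crossing arcs. -/
def IsPTriangulation (m : ℕ) (T : Finset (ℤ × ℤ)) : Prop :=
  T.card = m - 1 ∧ (∀ p ∈ T, IsPArc m p) ∧
    ∀ p ∈ T, ∀ q ∈ T, p ≠ q → ¬ PCross m p q

/-- A bicolouring: a function from the vertices to {red, blue} attaining both values
(`true` = blue, `false` = red). -/
def IsBicolouring (m : ℕ) (c : ZMod m → Bool) : Prop :=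
  (∃ v, c v = true) ∧ (∃ v, c v = false)

/-- A bicolouring is non-trivial if some arc has both endpoints red. -/
def IsNontrivialBicolouring (m : ℕ) (c : ZMod m → Bool) : Prop :=
  IsBicolouring m c ∧
    ∃ p : ℤ × ℤ, IsPArc m p ∧ c (p.1 : ZMod m) = false ∧ c (p.2 : ZMod m) = false

/-- An arc is permitted if at least one of its endpoints is blue. -/
def Permitted (m : ℕ) (c : ZMod m → Bool) (p : ℤ × ℤ) : Prop :=
  c (p.1 : ZMod m) = true ∨ c (p.2 : ZMod m) = true

/-- A permissible triangulation: a triangulation all of whose arcs are permitted. -/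
def IsPermissible (m : ℕ) (c : ZMod m → Bool) (T : Finset (ℤ × ℤ)) : Prop :=
  IsPTriangulation m T ∧ ∀ p ∈ T, Permitted m c p

/-- Two permissible triangulations are joined in the flip graph of permissible
triangulations: there is a finite sequence of permissible triangulations from one to the
other in which consecutive triangulations share exactly `m - 2` arcs. -/
def PermFlipJoined (m : ℕ) (c : ZMod m → Bool) (T₁ T₂ : Finset (ℤ × ℤ)) : Prop :=
  ∃ n : ℕ, ∃ f : Fin (n + 1) → Finset (ℤ × ℤ),
    f 0 = T₁ ∧ f (Fin.last n) = T₂ ∧ (∀ i, IsPermissible m c (f i)) ∧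
    ∀ i : Fin n, (f i.castSucc ∩ f i.succ).card = m - 2


/-! ### Arc systems on the universal cover -/

/-- A periodic set of pairwise non-crossing lifts of arcs of `P*_m`. -/
structure ArcSystem (m : ℕ) (P : ℤ → ℤ → Prop) : Prop where
  shift : ∀ {a b : ℤ} (k : ℤ), P a b → P (a + k * m) (b + k * m)
  two_le : ∀ {a b : ℤ}, P a b → a + 2 ≤ b
  le_period : ∀ {a b : ℤ}, P a b → b ≤ a + m
  noncrossing : ∀ {a b c d : ℤ}, P a b → P c d → a < c → c < b → d ≤ b

/-- Some arc of `P` passes strictly above the vertex `x`. -/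
def Enclosed (P : ℤ → ℤ → Prop) (x : ℤ) : Prop := ∃ a b, P a b ∧ a < x ∧ x < b

/-- `(a,b)` is the innermost arc of `P` passing strictly above the vertex `x`. -/
def Innermost (P : ℤ → ℤ → Prop) (x a b : ℤ) : Prop :=
  P a b ∧ a < x ∧ x < b ∧ ∀ c d, P c d → c < x → x < d → c ≤ a ∧ b ≤ d

namespace Innermost

variable {P Q : ℤ → ℤ → Prop} {x a b c d : ℤ}

theorem enclosed (h : Innermost P x a b) : Enclosed P x := ⟨a, b, h.1, h.2.1, h.2.2.1⟩

theorem unique (h : Innermost P x a b) (h' : Innermost P x c d) : a = c ∧ b = d := by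
  have h₁ := h.2.2.2 c d h'.1 h'.2.1 h'.2.2.1
  have h₂ := h'.2.2.2 a b h.1 h.2.1 h.2.2.1
  omega

theorem anti (h : Innermost P x a b) (hQ : ∀ c d, Q c d → P c d) (hab : Q a b) :
    Innermost Q x a b :=
  ⟨hab, h.2.1, h.2.2.1, fun c d hcd => h.2.2.2 c d (hQ c d hcd)⟩

end Innermost

namespace ArcSystem

variable {m : ℕ} {P : ℤ → ℤ → Prop} {a b c d x y : ℤ}

theorem enclosed_shift (hP : ArcSystem m P) (k : ℤ) (h : Enclosed P x) :
    Enclosed P (x + k * m) := by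
  obtain ⟨a, b, hab, h₁, h₂⟩ := h
  exact ⟨_, _, hP.shift k hab, by omega, by omega⟩

theorem enclosed_shift_iff (hP : ArcSystem m P) (k : ℤ) :
    Enclosed P (x + k * m) ↔ Enclosed P x := by
  refine ⟨fun h => ?_, hP.enclosed_shift k⟩
  have := hP.enclosed_shift (-k) h
  rwa [neg_mul, add_neg_cancel_right] at this

theorem innermost_shift (hP : ArcSystem m P) (k : ℤ) (h : Innermost P x a b) :
    Innermost P (x + k * m) (a + k * m) (b + k * m) := by
  obtain ⟨hab, h₁, h₂, h₃⟩ := h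
  refine ⟨hP.shift k hab, by omega, by omega, fun c d hcd hc hd => ?_⟩
  have := h₃ (c + (-k) * m) (d + (-k) * m) (hP.shift _ hcd) (by rw [neg_mul]; omega)
    (by rw [neg_mul]; omega)
  rw [neg_mul] at this
  omega

theorem exists_innermost (hP : ArcSystem m P) (h : Enclosed P x) :
    ∃ a b, Innermost P x a b := by
  classical
  have hn : ∃ n : ℕ, ∃ a b, P a b ∧ a < x ∧ x < b ∧ b - a = n := by
    obtain ⟨a, b, hab, h₁, h₂⟩ := h
    exact ⟨(b - a).toNat, a, b, hab, h₁, h₂, by omega⟩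
  obtain ⟨a, b, hab, h₁, h₂, hlen⟩ := Nat.find_spec hn
  refine ⟨a, b, hab, h₁, h₂, fun c d hcd hc hd => ?_⟩
  have hmin := Nat.find_min' hn ⟨c, d, hcd, hc, hd, (by omega : d - c = (d - c).toNat)⟩
  have h₃ : a < c → d ≤ b := fun hac => hP.noncrossing hab hcd hac (by omega)
  have h₄ : c < a → b ≤ d := fun hca => hP.noncrossing hcd hab hca (by omega)
  omega

/-- Every arc is innermost above some vertex, its apex. -/
theorem exists_apex (hP : ArcSystem m P) (hab : P a b) : ∃ x, Innermost P x a b := by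
  classical
  have hlen := hP.two_le hab
  obtain ⟨x, hx, hmax⟩ := Finset.exists_max_image
    ((Finset.Ioo a b).filter fun x => x = a + 1 ∨ P a x) id
    ⟨a + 1, by simp only [Finset.mem_filter, Finset.mem_Ioo, true_or, and_true]; omega⟩
  simp only [Finset.mem_filter, Finset.mem_Ioo, id] at hx hmax
  obtain ⟨⟨hax, hxb⟩, hx⟩ := hx
  refine ⟨x, hab, hax, hxb, fun d e hde hd he => ?_⟩
  have hda : d ≤ a := by
    by_contra hlt
    rcases hx with hx | hx
    · omega
    · have := hP.noncrossing hx hde (by omega) hd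
      omega
  refine ⟨hda, ?_⟩
  by_contra hlt
  rcases hda.lt_or_eq with hlt' | rfl
  · have := hP.noncrossing hde hab hlt' (by omega)
    omega
  · have := hmax e ⟨⟨by omega, by omega⟩, Or.inr hde⟩
    omega

/-- The outermost arc above an enclosed vertex has endpoints that are not enclosed. -/
theorem exists_outermost (hP : ArcSystem m P) (h : Enclosed P x) :
    ∃ a b, P a b ∧ a < x ∧ x < b ∧ ¬ Enclosed P a ∧ ¬ Enclosed P b := by
  classical
  have hn : ∃ n : ℕ, ∃ a b, P a b ∧ a < x ∧ x < b ∧ m - (b - a) = n := by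
    obtain ⟨a, b, hab, h₁, h₂⟩ := h
    have := hP.le_period hab
    exact ⟨(m - (b - a)).toNat, a, b, hab, h₁, h₂, by omega⟩
  obtain ⟨a, b, hab, h₁, h₂, hlen⟩ := Nat.find_spec hn
  have hmax : ∀ c d, P c d → c < x → x < d → d - c ≤ b - a := by
    intro c d hcd hc hd
    have := hP.le_period hcd
    have hmin := Nat.find_min' hn
      ⟨c, d, hcd, hc, hd, (by omega : m - (d - c) = (m - (d - c)).toNat)⟩
    omega
  refine ⟨a, b, hab, h₁, h₂, ?_, ?_⟩
  · rintro ⟨c, d, hcd, hc, hd⟩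
    have := hP.noncrossing hcd hab hc hd
    have := hmax c d hcd (by omega) (by omega)
    omega
  · rintro ⟨c, d, hcd, hc, hd⟩
    have hca : c ≤ a := by
      by_contra hlt
      have := hP.noncrossing hab hcd (by omega) hc
      omega
    have := hmax c d hcd (by omega) (by omega)
    omega

theorem exists_not_enclosed (hP : ArcSystem m P) : ∃ x, ¬ Enclosed P x := by
  by_contra! h
  obtain ⟨a, -, -, -, -, ha, -⟩ := hP.exists_outermost (h 0)
  exact ha (h a)

/-- An arc from the left end of `(a,b)` to a vertex of the same region crosses nothing. -/
theorem left_compatible (hP : ArcSystem m P) (hy : Innermost P y a b) (hcd : P c d) :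
    (a < c → c < y → d ≤ y) ∧ (c < a → a < d → y ≤ d) := by
  obtain ⟨hab, h₁, h₂, h₃⟩ := hy
  constructor
  · intro hac hcy
    by_contra hlt
    have := h₃ c d hcd hcy (by omega)
    omega
  · intro hca had
    have := hP.noncrossing hcd hab hca had
    omega

/-- An arc from a vertex of the region below `(a,b)` to its right end crosses nothing. -/
theorem right_compatible (hP : ArcSystem m P) (hx : Innermost P x a b) (hcd : P c d) :
    (x < c → c < b → d ≤ b) ∧ (c < x → x < d → b ≤ d) := by
  obtain ⟨hab, h₁, h₂, h₃⟩ := hx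
  exact ⟨fun hxc hcb => hP.noncrossing hab hcd (by omega) hcb,
    fun hcx hxd => (h₃ c d hcd hcx hxd).2⟩

/-- The maximal arc based at a vertex that is not enclosed crosses nothing. -/
theorem loop_compatible (hP : ArcSystem m P) (hx : ¬ Enclosed P x) (hcd : P c d) :
    (x < c → c < x + m → d ≤ x + m) ∧ (c < x → x < d → x + m ≤ d) := by
  constructor
  · intro _ hc
    by_contra hlt
    exact hx ((hP.enclosed_shift_iff 1).1 ⟨c, d, hcd, by omega, by omega⟩)
  · intro hc hd
    exact absurd ⟨c, d, hcd, hc, hd⟩ hx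

end ArcSystem

/-! ### Canonical representatives -/

/-- The canonical representative of the class of `(a,b)`. -/
def canon (m : ℕ) (a b : ℤ) : ℤ × ℤ := (a % m, a % m + (b - a))

/-- `(a,b)` is a lift of an arc in `T`. -/
def Lift (m : ℕ) (T : Finset (ℤ × ℤ)) (a b : ℤ) : Prop := canon m a b ∈ T

/-- A set of pairwise non-crossing arcs. -/
def IsNoncrossing (m : ℕ) (T : Finset (ℤ × ℤ)) : Prop :=
  (∀ p ∈ T, IsPArc m p) ∧ ∀ p ∈ T, ∀ q ∈ T, p ≠ q → ¬ PCross m p q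

section Canon

variable {m : ℕ} {S T : Finset (ℤ × ℤ)} {a b c d x y : ℤ} {p : ℤ × ℤ}

theorem canon_shift (k : ℤ) : canon m (a + k * m) (b + k * m) = canon m a b := by
  simp [canon]

theorem canon_of_isPArc (hp : IsPArc m p) : canon m p.1 p.2 = p := by
  obtain ⟨h₁, h₂, -, -⟩ := hp
  ext <;> simp [canon, Int.emod_eq_of_lt h₁ h₂]

theorem canon_eq_shift (m : ℕ) (a b : ℤ) :
    canon m a b = (a + -(a / m) * m, b + -(a / m) * m) := by
  have := Int.emod_add_mul_ediv a m
  rw [mul_comm] at this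
  ext <;> simp only [canon, neg_mul] <;> omega

theorem exists_shift_of_canon_eq (h : canon m a b = canon m c d) :
    ∃ k : ℤ, c = a + k * m ∧ d = b + k * m := by
  rw [canon_eq_shift, canon_eq_shift, Prod.mk.injEq] at h
  refine ⟨c / m - a / m, ?_⟩
  rw [sub_mul]
  simp only [neg_mul] at h
  omega

theorem isPArc_canon (hm : 2 ≤ m) (h₁ : a + 2 ≤ b) (h₂ : b ≤ a + m) :
    IsPArc m (canon m a b) := by
  have := Int.emod_nonneg a (by omega : (m : ℤ) ≠ 0)
  have := Int.emod_lt_of_pos a (by omega : (0 : ℤ) < m)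
  simp only [IsPArc, canon]
  omega

theorem lift_of_mem (hT : IsNoncrossing m T) (hp : p ∈ T) : Lift m T p.1 p.2 := by
  rwa [Lift, canon_of_isPArc (hT.1 p hp)]

theorem permitted_canon {col : ZMod m → Bool} :
    Permitted m col (canon m a b) ↔ col a = true ∨ col b = true := by
  rw [canon_eq_shift]
  simp [Permitted]

theorem eq_zero_of_mul_lt {k n : ℤ} (h₁ : -n < k * n) (h₂ : k * n < n) : k = 0 := by
  have hn : 0 < n := by omega
  by_contra hk
  rcases lt_or_gt_of_ne hk with hk | hk <;> nlinarith

namespace IsNoncrossing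

theorem arcSystem (hT : IsNoncrossing m T) : ArcSystem m (Lift m T) where
  shift k h := by rwa [Lift, canon_shift]
  two_le h := by
    have := (hT.1 _ h).2.2.1
    simp only [canon] at this
    omega
  le_period h := by
    have := (hT.1 _ h).2.2.2
    simp only [canon] at this
    omega
  noncrossing {a b c d} h h' hac hcb := by
    by_contra hbd
    have hlen := (hT.1 _ h).2.2.2
    simp only [canon] at hlen
    by_cases heq : canon m a b = canon m c d
    · obtain ⟨k, hk, hk'⟩ := exists_shift_of_canon_eq heq
      have := eq_zero_of_mul_lt (k := k) (n := m) (by omega) (by omega)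
      subst this
      omega
    · refine hT.2 _ h _ h' heq ?_
      rw [canon_eq_shift, canon_eq_shift]
      refine ⟨a / m - c / m, Or.inl ?_⟩
      simp only [sub_mul, neg_mul]
      omega

theorem subset (hT : IsNoncrossing m T) (h : S ⊆ T) : IsNoncrossing m S :=
  ⟨fun p hp => hT.1 p (h hp), fun p hp q hq => hT.2 p (h hp) q (h hq)⟩

theorem insert_canon (hm : 2 ≤ m) (hS : IsNoncrossing m S) (h₁ : a + 2 ≤ b) (h₂ : b ≤ a + m)
    (h : ∀ c d, Lift m S c d → (a < c → c < b → d ≤ b) ∧ (c < a → a < d → b ≤ d)) :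
    IsNoncrossing m (insert (canon m a b) S) := by
  have key : ∀ q ∈ S, ¬ PCross m (canon m a b) q ∧ ¬ PCross m q (canon m a b) := by
    intro q hq
    have hq' := lift_of_mem hS hq
    have hsh := fun k => h _ _ (hS.arcSystem.shift k hq')
    rw [canon_eq_shift]
    constructor
    · rintro ⟨k, hk⟩
      have := hsh (a / m - k)
      simp only [neg_mul, sub_mul] at this hk
      omega
    · rintro ⟨k, hk⟩
      have := hsh (a / m + k)
      simp only [neg_mul, add_mul] at this hk
      omega
  refine ⟨?_, ?_⟩
  · intro p hp
    rcases Finset.mem_insert.1 hp with rfl | hp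
    · exact isPArc_canon hm h₁ h₂
    · exact hS.1 p hp
  · intro p hp q hq hpq
    rcases Finset.mem_insert.1 hp with rfl | hp <;> rcases Finset.mem_insert.1 hq with rfl | hq
    · exact absurd rfl hpq
    · exact (key q hq).1
    · exact (key p hp).2
    · exact hS.2 p hp q hq hpq

theorem insert_left (hm : 2 ≤ m) (hS : IsNoncrossing m S) (hx : Innermost (Lift m S) x a b)
    (hy : Innermost (Lift m S) y a b) (hxy : x < y) :
    IsNoncrossing m (insert (canon m a y) S) ∧ canon m a y ∉ S := by
  have hlen := hS.arcSystem.le_period hx.1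
  obtain ⟨-, h₁, -, h₂⟩ := hx
  refine ⟨hS.insert_canon hm (by omega) (by have := hy.2.2.1; omega)
    fun c d hcd => hS.arcSystem.left_compatible hy hcd, fun hmem => ?_⟩
  have := h₂ a y hmem h₁ hxy
  have := hy.2.2.1
  omega

theorem insert_right (hm : 2 ≤ m) (hS : IsNoncrossing m S) (hx : Innermost (Lift m S) x a b)
    (hy : Innermost (Lift m S) y a b) (hxy : x < y) :
    IsNoncrossing m (insert (canon m x b) S) ∧ canon m x b ∉ S := by
  have hlen := hS.arcSystem.le_period hx.1
  obtain ⟨-, -, h₁, h₂⟩ := hy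
  refine ⟨hS.insert_canon hm (by omega) (by have := hx.2.1; omega)
    fun c d hcd => hS.arcSystem.right_compatible hx hcd, fun hmem => ?_⟩
  have := h₂ x b hmem hxy h₁
  have := hx.2.1
  omega

theorem insert_loop (hm : 2 ≤ m) (hS : IsNoncrossing m S) (hx : ¬ Enclosed (Lift m S) x) :
    IsNoncrossing m (insert (canon m x (x + m)) S) :=
  hS.insert_canon hm (by omega) le_rfl fun _ _ hcd => hS.arcSystem.loop_compatible hx hcd

end IsNoncrossing

end Canon

/-! ### Counting arcs by their apices -/

section Counting

variable {m : ℕ} {S T : Finset (ℤ × ℤ)} {a b c d x y : ℤ} {p : ℤ × ℤ}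

theorem exists_mem_Ico_shift (hm : 2 ≤ m) (x : ℤ) :
    ∃ k : ℤ, x + k * m ∈ Finset.Ico (0 : ℤ) m := by
  refine ⟨-(x / m), ?_⟩
  have h := Int.emod_add_mul_ediv x m
  rw [mul_comm] at h
  have := Int.emod_nonneg x (by omega : (m : ℤ) ≠ 0)
  have := Int.emod_lt_of_pos x (by omega : (0 : ℤ) < m)
  rw [Finset.mem_Ico, neg_mul]
  omega

namespace IsNoncrossing

/-- Sending each arc to its apex modulo `m` is injective. -/
theorem exists_apex_injOn (hm : 2 ≤ m) (hT : IsNoncrossing m T) :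
    ∃ g : ℤ × ℤ → ℤ, Set.InjOn g T ∧ ∀ p ∈ T, g p ∈ Finset.Ico (0 : ℤ) m ∧
      ∃ k : ℤ, Innermost (Lift m T) (g p + k * m) p.1 p.2 := by
  have hP := hT.arcSystem
  have key : ∀ p ∈ T, ∃ x ∈ Finset.Ico (0 : ℤ) m, ∃ k : ℤ,
      Innermost (Lift m T) (x + k * m) p.1 p.2 := by
    intro p hp
    obtain ⟨x, hx⟩ := hP.exists_apex (lift_of_mem hT hp)
    obtain ⟨k, hk⟩ := exists_mem_Ico_shift hm x
    refine ⟨_, hk, -k, ?_⟩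
    rwa [neg_mul, add_neg_cancel_right]
  choose! g hg h using key
  refine ⟨g, ?_, fun p hp => ⟨hg p hp, h p hp⟩⟩
  intro p hp q hq hpq
  obtain ⟨k, hk⟩ := h p hp
  obtain ⟨l, hl⟩ := h q hq
  have hk' := hP.innermost_shift (l - k) hk
  rw [show g p + k * m + (l - k) * m = g q + l * m by rw [hpq]; ring] at hk'
  obtain ⟨h₁, h₂⟩ := hk'.unique hl
  rw [← canon_of_isPArc (hT.1 p hp), ← canon_of_isPArc (hT.1 q hq), ← h₁, ← h₂, canon_shift]

theorem exists_not_enclosed_mem (hm : 2 ≤ m) (hT : IsNoncrossing m T) :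
    ∃ u ∈ Finset.Ico (0 : ℤ) m, ¬ Enclosed (Lift m T) u := by
  obtain ⟨u, hu⟩ := hT.arcSystem.exists_not_enclosed
  obtain ⟨k, hk⟩ := exists_mem_Ico_shift hm u
  exact ⟨_, hk, by rwa [hT.arcSystem.enclosed_shift_iff]⟩

theorem apex_maps_to (hT : IsNoncrossing m T) {g : ℤ × ℤ → ℤ} {u : ℤ}
    (hg : ∀ p ∈ T, g p ∈ Finset.Ico (0 : ℤ) m ∧
      ∃ k : ℤ, Innermost (Lift m T) (g p + k * m) p.1 p.2)
    (hu : ¬ Enclosed (Lift m T) u) :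
    Set.MapsTo g T ((Finset.Ico (0 : ℤ) m).erase u : Finset ℤ) := by
  intro p hp
  obtain ⟨h₁, k, h₂⟩ := hg p hp
  refine Finset.mem_coe.2 (Finset.mem_erase.2 ⟨?_, h₁⟩)
  rintro rfl
  exact hu ((hT.arcSystem.enclosed_shift_iff k).1 h₂.enclosed)

theorem card_Ico_erase {u : ℤ} (hu : u ∈ Finset.Ico (0 : ℤ) m) :
    ((Finset.Ico (0 : ℤ) m).erase u).card = m - 1 := by
  simp [Finset.card_erase_of_mem hu]

theorem card_le (hm : 2 ≤ m) (hT : IsNoncrossing m T) : T.card ≤ m - 1 := by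
  obtain ⟨g, hinj, hg⟩ := hT.exists_apex_injOn hm
  obtain ⟨u, hu, hue⟩ := hT.exists_not_enclosed_mem hm
  rw [← card_Ico_erase hu]
  exact Finset.card_le_card_of_injOn g (hT.apex_maps_to hg hue) hinj

/-- A set of fewer than `m - 1` arcs has two vertices in a common region which are not
joined by an arc. -/
theorem exists_defect (hm : 2 ≤ m) (hT : IsNoncrossing m T) (hcard : T.card < m - 1) :
    (∃ x y : ℤ, x < y ∧ y < x + m ∧ ¬ Enclosed (Lift m T) x ∧ ¬ Enclosed (Lift m T) y) ∨
      ∃ a b x y, x < y ∧ Innermost (Lift m T) x a b ∧ Innermost (Lift m T) y a b := by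
  have hP := hT.arcSystem
  obtain ⟨u, hu, hue⟩ := hT.exists_not_enclosed_mem hm
  by_cases h : ∃ v ∈ Finset.Ico (0 : ℤ) m, v ≠ u ∧ ¬ Enclosed (Lift m T) v
  · obtain ⟨v, hv, hvu, hve⟩ := h
    rw [Finset.mem_Ico] at hu hv
    rcases lt_or_gt_of_ne hvu with hlt | hlt
    · exact Or.inl ⟨v, u, hlt, by omega, hve, hue⟩
    · exact Or.inl ⟨u, v, hlt, by omega, hue, hve⟩
  · push Not at h
    right
    have key : ∀ x ∈ (Finset.Ico (0 : ℤ) m).erase u, ∃ p ∈ T, ∃ k : ℤ,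
        Innermost (Lift m T) (x + k * m) p.1 p.2 := by
      intro x hx
      rw [Finset.mem_erase] at hx
      obtain ⟨a, b, hab⟩ := hP.exists_innermost (h x hx.2 hx.1)
      refine ⟨canon m a b, hab.1, -(a / m), ?_⟩
      rw [canon_eq_shift]
      exact hP.innermost_shift _ hab
    choose! e he hk using key
    obtain ⟨x, hx, y, hy, hxy, hexy⟩ := Finset.exists_ne_map_eq_of_card_lt_of_maps_to
      (by rwa [card_Ico_erase hu]) he
    obtain ⟨k, hk₁⟩ := hk x hx
    obtain ⟨l, hl₁⟩ := hk y hy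
    rw [← hexy] at hl₁
    have hne : x + k * m ≠ y + l * m := by
      intro heq
      simp only [Finset.mem_erase, Finset.mem_Ico] at hx hy
      have := eq_zero_of_mul_lt (k := k - l) (n := m) (by rw [sub_mul]; omega)
        (by rw [sub_mul]; omega)
      rw [sub_eq_zero] at this
      subst this
      omega
    rcases lt_or_gt_of_ne hne with hlt | hlt
    · exact ⟨_, _, _, _, hlt, hk₁, hl₁⟩
    · exact ⟨_, _, _, _, hlt, hl₁, hk₁⟩

end IsNoncrossing

end Counting

/-! ### Triangulations -/

theorem IsPTriangulation.isNoncrossing {m : ℕ} {T : Finset (ℤ × ℤ)}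
    (hT : IsPTriangulation m T) : IsNoncrossing m T := hT.2

namespace IsPTriangulation

variable {m : ℕ} {S T : Finset (ℤ × ℤ)} {a b c d x y z v : ℤ} {p : ℤ × ℤ}

theorem apex_surjOn (hT : IsPTriangulation m T) {g : ℤ × ℤ → ℤ}
    (hinj : Set.InjOn g T) (hg : ∀ p ∈ T, g p ∈ Finset.Ico (0 : ℤ) m ∧
      ∃ k : ℤ, Innermost (Lift m T) (g p + k * m) p.1 p.2)
    {u : ℤ} (hu : u ∈ Finset.Ico (0 : ℤ) m) (hue : ¬ Enclosed (Lift m T) u) :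
    ∀ x ∈ Finset.Ico (0 : ℤ) m, x ≠ u → ∃ p ∈ T, g p = x := by
  have hmaps := hT.isNoncrossing.apex_maps_to hg hue
  have hsurj := Finset.surjOn_of_injOn_of_card_le g hmaps hinj
    (by rw [IsNoncrossing.card_Ico_erase hu, hT.1])
  intro x hx hxu
  exact hsurj (Finset.mem_coe.2 (Finset.mem_erase.2 ⟨hxu, hx⟩))

theorem exists_shift_of_not_enclosed (hm : 2 ≤ m) (hT : IsPTriangulation m T)
    (hx : ¬ Enclosed (Lift m T) x) (hy : ¬ Enclosed (Lift m T) y) :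
    ∃ k : ℤ, y = x + k * m := by
  have hP := hT.isNoncrossing.arcSystem
  obtain ⟨g, hinj, hg⟩ := hT.isNoncrossing.exists_apex_injOn hm
  obtain ⟨k, hk⟩ := exists_mem_Ico_shift hm x
  obtain ⟨l, hl⟩ := exists_mem_Ico_shift hm y
  by_cases heq : y + l * m = x + k * m
  · exact ⟨k - l, by rw [sub_mul]; omega⟩
  · obtain ⟨p, hp, hgp⟩ := hT.apex_surjOn hinj hg hk
      (by rwa [hP.enclosed_shift_iff]) _ hl heq
    obtain ⟨-, j, hj⟩ := hg p hp
    rw [hgp] at hj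
    exact absurd ((hP.enclosed_shift_iff _).1 ((hP.enclosed_shift_iff _).1 hj.enclosed)) hy

/-- Every region of a triangulation away from the puncture is a triangle. -/
theorem innermost_injective (hm : 2 ≤ m) (hT : IsPTriangulation m T)
    (hx : Innermost (Lift m T) x a b) (hy : Innermost (Lift m T) y a b) : x = y := by
  have hP := hT.isNoncrossing.arcSystem
  obtain ⟨g, hinj, hg⟩ := hT.isNoncrossing.exists_apex_injOn hm
  obtain ⟨u, hu, hue⟩ := hT.isNoncrossing.exists_not_enclosed_mem hm
  have key : ∀ z, Innermost (Lift m T) z a b → ∃ k : ℤ, g (canon m a b) = z + k * m := by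
    intro z hz
    obtain ⟨k, hk⟩ := exists_mem_Ico_shift hm z
    have hne : z + k * m ≠ u := by
      rintro rfl
      exact hue (hP.enclosed_shift k hz.enclosed)
    obtain ⟨p, hp, hgp⟩ := hT.apex_surjOn hinj hg hu hue _ hk hne
    obtain ⟨-, j, hj⟩ := hg p hp
    have hz' := hP.innermost_shift (k + j) hz
    rw [show z + (k + j) * m = g p + j * m by rw [hgp]; ring] at hz'
    obtain ⟨h₁, h₂⟩ := hz'.unique hj
    have hpc : canon m a b = p := by
      rw [← canon_of_isPArc (hT.2.1 p hp), ← h₁, ← h₂, canon_shift]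
    exact ⟨k, hpc ▸ hgp⟩
  obtain ⟨k, hk⟩ := key x hx
  obtain ⟨l, hl⟩ := key y hy
  have hlen := hP.le_period hx.1
  obtain ⟨-, h₁, h₂, -⟩ := hx
  obtain ⟨-, h₃, h₄, -⟩ := hy
  have := eq_zero_of_mul_lt (k := k - l) (n := m) (by rw [sub_mul]; omega)
    (by rw [sub_mul]; omega)
  rw [sub_eq_zero] at this
  subst this
  omega

theorem lift_loop (hm : 2 ≤ m) (hT : IsPTriangulation m T) (hx : ¬ Enclosed (Lift m T) x) :
    Lift m T x (x + m) := by
  by_contra hmem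
  have hcard := (hT.isNoncrossing.insert_loop hm hx).card_le hm
  rw [Finset.card_insert_of_notMem hmem, hT.1] at hcard
  omega

end IsPTriangulation

/-! ### Extending and completing partial triangulations -/

section Completion

variable {m : ℕ} {S T : Finset (ℤ × ℤ)} {a b c d x y : ℤ} {p : ℤ × ℤ} {col : ZMod m → Bool}

theorem exists_insert_permitted (hm : 2 ≤ m) (hcol : ∃ v, col v = true)
    (hS : IsNoncrossing m S) (hperm : ∀ p ∈ S, Permitted m col p) (hcard : S.card < m - 1) :
    ∃ p ∉ S, IsNoncrossing m (insert p S) ∧ Permitted m col p := by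
  have hP := hS.arcSystem
  rcases hS.exists_defect hm hcard with ⟨x, y, hxy, hyx, hx, hy⟩ | ⟨a, b, x, y, hxy, hx, hy⟩
  · obtain ⟨w, hw, hwcol⟩ : ∃ w : ℤ, ¬ Enclosed (Lift m S) w ∧ col w = true := by
      obtain ⟨v, hv⟩ := hcol
      obtain ⟨v, rfl⟩ := ZMod.intCast_surjective v
      by_cases hve : Enclosed (Lift m S) v
      · obtain ⟨a, b, hab, -, -, ha, hb⟩ := hP.exists_outermost hve
        rcases permitted_canon.1 (hperm _ hab) with h | h
        · exact ⟨a, ha, h⟩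
        · exact ⟨b, hb, h⟩
      · exact ⟨v, hve, hv⟩
    refine ⟨canon m w (w + m), fun hmem => ?_, hS.insert_loop hm hw,
      permitted_canon.2 (Or.inl hwcol)⟩
    have key : ∀ z, ¬ Enclosed (Lift m S) z → ∃ k : ℤ, z = w + k * m := by
      intro z hz
      have hm' : (0 : ℤ) < m := by omega
      refine ⟨(z - w) / m, ?_⟩
      have h := Int.emod_add_mul_ediv (z - w) m
      rw [mul_comm] at h
      have h₁ := Int.emod_nonneg (z - w) hm'.ne'
      have h₂ := Int.emod_lt_of_pos (z - w) hm'
      by_contra hne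
      refine hz ((hP.enclosed_shift_iff (-((z - w) / m))).1 ⟨w, w + m, hmem, ?_, ?_⟩) <;>
        rw [neg_mul] <;> omega
    obtain ⟨k, hk⟩ := key x hx
    obtain ⟨l, hl⟩ := key y hy
    have := eq_zero_of_mul_lt (k := l - k) (n := m) (by rw [sub_mul]; omega)
      (by rw [sub_mul]; omega)
    rw [sub_eq_zero] at this
    subst this
    omega
  · rcases permitted_canon.1 (hperm _ hx.1) with h | h
    · obtain ⟨h₁, h₂⟩ := hS.insert_left hm hx hy hxy
      exact ⟨_, h₂, h₁, permitted_canon.2 (Or.inl h)⟩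
    · obtain ⟨h₁, h₂⟩ := hS.insert_right hm hx hy hxy
      exact ⟨_, h₂, h₁, permitted_canon.2 (Or.inr h)⟩

theorem exists_isPermissible_superset (hm : 2 ≤ m) (hcol : ∃ v, col v = true)
    (hS : IsNoncrossing m S) (hperm : ∀ p ∈ S, Permitted m col p) :
    ∃ T, IsPermissible m col T ∧ S ⊆ T := by
  induction hn : m - 1 - S.card generalizing S with
  | zero => exact ⟨S, ⟨⟨by have := hS.card_le hm; omega, hS⟩, hperm⟩, subset_rfl⟩
  | succ n ih =>
    obtain ⟨p, hp, hins, hpp⟩ := exists_insert_permitted hm hcol hS hperm (by omega)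
    obtain ⟨T, hT, hST⟩ := ih hins
      (fun q hq => (Finset.mem_insert.1 hq).elim (fun h => h ▸ hpp) (hperm q))
      (by rw [Finset.card_insert_of_notMem hp]; omega)
    exact ⟨T, hT, (Finset.subset_insert _ _).trans hST⟩

theorem lift_insert (h : Lift m (insert p S) c d) : Lift m S c d ∨ p = canon m c d :=
  (Finset.mem_insert.1 h).symm.imp_right Eq.symm

theorem Lift.mono (hST : S ⊆ T) (h : Lift m S a b) : Lift m T a b := hST h

/-- The added arc changes the region below at most one vertex. -/
theorem exists_shift_of_innermost_insert (hm : 2 ≤ m) (hT : IsPTriangulation m (insert p S))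
    {a' b' : ℤ} (hx : Innermost (Lift m (insert p S)) x a b)
    (hy : Innermost (Lift m (insert p S)) y a' b') (hab : ¬ Lift m S a b)
    (hab' : ¬ Lift m S a' b') : ∃ k : ℤ, y = x + k * m := by
  have h := (lift_insert hx.1).resolve_left hab
  have h' := (lift_insert hy.1).resolve_left hab'
  obtain ⟨k, rfl, rfl⟩ := exists_shift_of_canon_eq (h.symm.trans h')
  exact ⟨k, (hT.innermost_injective hm
    (hT.isNoncrossing.arcSystem.innermost_shift k hx) hy).symm⟩

theorem not_exists_shift (hxy : x < y) (hyx : y < x + m) : ¬ ∃ k : ℤ, y = x + k * m := by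
  rintro ⟨k, rfl⟩
  have := eq_zero_of_mul_lt (k := k) (n := m) (by omega) (by omega)
  subst this
  omega

theorem eq_loop_of_enclosed_insert (hm : 2 ≤ m) (hT : IsPTriangulation m (insert p S))
    (hx : ¬ Enclosed (Lift m S) x) (hxT : Enclosed (Lift m (insert p S)) x)
    (hyT : ¬ Enclosed (Lift m (insert p S)) y) : p = canon m y (y + m) := by
  have hP := hT.isNoncrossing.arcSystem
  obtain ⟨d, e, hde, h₁, h₂, hd, he⟩ := hP.exists_outermost hxT
  have hp := (lift_insert hde).resolve_left fun h => hx ⟨d, e, h, h₁, h₂⟩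
  obtain ⟨k, rfl⟩ := hT.exists_shift_of_not_enclosed hm hd he
  obtain ⟨l, rfl⟩ := hT.exists_shift_of_not_enclosed hm hd hyT
  have hlen := hP.le_period hde
  have hk := eq_zero_of_mul_lt (k := k - 1) (n := m) (by rw [sub_mul]; omega)
    (by rw [sub_mul]; omega)
  obtain rfl : k = 1 := by omega
  rw [hp, one_mul, add_right_comm, canon_shift]

/-- Completing a set of arcs whose puncture region has two vertices. -/
theorem completion_of_not_enclosed (hm : 2 ≤ m) (hxy : x < y) (hyx : y < x + m)
    (hx : ¬ Enclosed (Lift m S) x) (hy : ¬ Enclosed (Lift m S) y)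
    (hT : IsPTriangulation m (insert p S)) :
    p = canon m x (x + m) ∨ p = canon m y (y + m) := by
  have hP := hT.isNoncrossing.arcSystem
  by_cases hxT : Enclosed (Lift m (insert p S)) x <;>
    by_cases hyT : Enclosed (Lift m (insert p S)) y
  · obtain ⟨a, b, hab⟩ := hP.exists_innermost hxT
    obtain ⟨c, d, hcd⟩ := hP.exists_innermost hyT
    exact absurd (exists_shift_of_innermost_insert hm hT hab hcd
      (fun h => hx ⟨a, b, h, hab.2.1, hab.2.2.1⟩) fun h => hy ⟨c, d, h, hcd.2.1, hcd.2.2.1⟩)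
      (not_exists_shift hxy hyx)
  · exact Or.inr (eq_loop_of_enclosed_insert hm hT hx hxT hyT)
  · exact Or.inl (eq_loop_of_enclosed_insert hm hT hy hyT hxT)
  · exact absurd (hT.exists_shift_of_not_enclosed hm hxT hyT) (not_exists_shift hxy hyx)

/-- An arc added inside a region of `S` ends at vertices of that region. -/
theorem innermost_insert_endpoints (hT : IsPTriangulation m (insert p S))
    (hx : Innermost (Lift m S) x a b) (hcd : Innermost (Lift m (insert p S)) x c d)
    (hS : ¬ Lift m S c d) :
    (a < c → Innermost (Lift m (insert p S)) c a b) ∧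
      (d < b → Innermost (Lift m (insert p S)) d a b) := by
  have hP := hT.isNoncrossing.arcSystem
  have hlen := hP.le_period hcd.1
  have hp := (lift_insert hcd.1).resolve_left hS
  obtain ⟨hcdT, hcx, hxd, hmin⟩ := hcd
  obtain ⟨habS, hax, hxb, hminS⟩ := hx
  have hsub := Finset.subset_insert p S
  have habT := habS.mono hsub
  have key : ∀ z, z = c ∨ z = d → ∀ f g, Lift m (insert p S) f g → f < z → z < g →
      f ≤ a ∧ b ≤ g := by
    intro z hz f g hfg hfz hzg
    rcases lift_insert hfg with hfgS | hfgp
    · refine hminS f g hfgS ?_ ?_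
      · rcases hz with rfl | rfl
        · omega
        · by_contra hlt
          have := hP.noncrossing hcdT hfg (by omega) hfz
          omega
      · rcases hz with rfl | rfl
        · have := hP.noncrossing hfg hcdT hfz hzg
          omega
        · omega
    · obtain ⟨k, rfl, rfl⟩ := exists_shift_of_canon_eq (hp.symm.trans hfgp)
      have := eq_zero_of_mul_lt (k := k) (n := m) (by omega) (by omega)
      subst this
      omega
  have := hmin a b habT hax hxb
  exact ⟨fun h => ⟨habT, h, by omega, key c (Or.inl rfl)⟩,
    fun h => ⟨habT, by omega, h, key d (Or.inr rfl)⟩⟩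

/-- Completing a set of arcs one of whose regions has two apices. -/
theorem completion_of_innermost (hm : 2 ≤ m) (hxy : x < y)
    (hx : Innermost (Lift m S) x a b) (hy : Innermost (Lift m S) y a b)
    (hT : IsPTriangulation m (insert p S)) :
    p = canon m a y ∨ p = canon m x b := by
  have hP := hT.isNoncrossing.arcSystem
  have hsub := Finset.subset_insert p S
  have hlift : ∀ c d, Lift m S c d → Lift m (insert p S) c d := fun c d h => h.mono hsub
  have henc : ∀ {z}, Innermost (Lift m S) z a b → Enclosed (Lift m (insert p S)) z :=
    fun h => ⟨a, b, h.1.mono hsub, h.2.1, h.2.2.1⟩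
  obtain ⟨c, d, hcd⟩ := hP.exists_innermost (henc hx)
  obtain ⟨e, f, hef⟩ := hP.exists_innermost (henc hy)
  have hlen := hP.le_period (hx.1.mono hsub)
  have hxy' := hx.2.1
  have hxy'' := hy.2.2.1
  have hxin := hcd.2.2.2 a b (hx.1.mono hsub) hx.2.1 hx.2.2.1
  have hyin := hef.2.2.2 a b (hy.1.mono hsub) hy.2.1 hy.2.2.1
  by_cases hcdS : Lift m S c d <;> by_cases hefS : Lift m S e f
  · obtain ⟨rfl, rfl⟩ := hx.unique (hcd.anti hlift hcdS)
    obtain ⟨rfl, rfl⟩ := hy.unique (hef.anti hlift hefS)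
    have := hT.innermost_injective hm hcd hef
    omega
  · obtain ⟨rfl, rfl⟩ := hx.unique (hcd.anti hlift hcdS)
    obtain ⟨h₁, h₂⟩ := innermost_insert_endpoints hT hy hef hefS
    have h₃ : a < e → e = x := fun h => hT.innermost_injective hm (h₁ h) hcd
    have h₄ : f < b → f = x := fun h => hT.innermost_injective hm (h₂ h) hcd
    have h₅ := hcd.2.2.2 e f hef.1
    have h₆ := hef.2.1
    have h₇ := hef.2.2.1
    have hne : ¬ (e = a ∧ f = b) := fun h => hefS (h.1 ▸ h.2 ▸ hx.1)
    obtain rfl : f = b := by omega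
    obtain rfl : e = x := by omega
    exact Or.inr ((lift_insert hef.1).resolve_left hefS)
  · obtain ⟨rfl, rfl⟩ := hy.unique (hef.anti hlift hefS)
    obtain ⟨h₁, h₂⟩ := innermost_insert_endpoints hT hx hcd hcdS
    have h₃ : a < c → c = y := fun h => hT.innermost_injective hm (h₁ h) hef
    have h₄ : d < b → d = y := fun h => hT.innermost_injective hm (h₂ h) hef
    have h₅ := hef.2.2.2 c d hcd.1
    have h₆ := hcd.2.1
    have h₇ := hcd.2.2.1
    have hne : ¬ (c = a ∧ d = b) := fun h => hcdS (h.1 ▸ h.2 ▸ hx.1)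
    obtain rfl : c = a := by omega
    obtain rfl : d = y := by omega
    exact Or.inl ((lift_insert hcd.1).resolve_left hcdS)
  · exact absurd (exists_shift_of_innermost_insert hm hT hcd hef hcdS hefS)
      (not_exists_shift hxy (by omega))

/-- A set of `m - 2` arcs has at most two completions to a triangulation. -/
theorem exists_completions (hm : 2 ≤ m) (hS : IsNoncrossing m S) (hcard : S.card = m - 2) :
    ∃ q r : ℤ × ℤ, ∀ T, IsPTriangulation m T → S ⊆ T → T = insert q S ∨ T = insert r S := by
  have hins : ∀ T, IsPTriangulation m T → S ⊆ T → ∃ p, insert p S = T := by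
    intro T hT hST
    obtain ⟨p, -, hp⟩ := (Finset.exists_eq_insert_iff (s := S) (t := T)).2
      ⟨hST, by rw [hcard, hT.1]; omega⟩
    exact ⟨p, hp⟩
  rcases hS.exists_defect hm (by omega) with ⟨x, y, hxy, hyx, hx, hy⟩ | ⟨a, b, x, y, hxy, hx, hy⟩
  · refine ⟨canon m x (x + m), canon m y (y + m), fun T hT hST => ?_⟩
    obtain ⟨p, rfl⟩ := hins T hT hST
    rcases completion_of_not_enclosed hm hxy hyx hx hy hT with rfl | rfl <;> simp
  · refine ⟨canon m a y, canon m x b, fun T hT hST => ?_⟩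
    obtain ⟨p, rfl⟩ := hins T hT hST
    rcases completion_of_innermost hm hxy hx hy hT with rfl | rfl <;> simp

end Completion

/-! ### Flips -/

/-- Two permissible triangulations sharing exactly `m - 2` arcs. -/
def IsFlip (m : ℕ) (col : ZMod m → Bool) (T T' : Finset (ℤ × ℤ)) : Prop :=
  IsPermissible m col T ∧ IsPermissible m col T' ∧ (T ∩ T').card = m - 2

section Flip

variable {m : ℕ} {T T' : Finset (ℤ × ℤ)} {a b c d x y z v : ℤ} {p q : ℤ × ℤ}
  {col : ZMod m → Bool}

theorem IsFlip.symm (h : IsFlip m col T T') : IsFlip m col T' T :=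
  ⟨h.2.1, h.1, by rw [Finset.inter_comm, h.2.2]⟩

theorem isFlip_insert_erase (hT : IsPermissible m col T) (hp : p ∈ T) (hq : q ∉ T)
    (hins : IsNoncrossing m (insert q (T.erase p))) (hperm : Permitted m col q) :
    IsFlip m col T (insert q (T.erase p)) := by
  have hpos := Finset.card_pos.2 ⟨p, hp⟩
  have hcard := hT.1.1
  refine ⟨hT, ⟨⟨?_, hins⟩, ?_⟩, ?_⟩
  · rw [Finset.card_insert_of_notMem fun h => hq (Finset.mem_of_mem_erase h),
      Finset.card_erase_of_mem hp]
    omega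
  · intro r hr
    rcases Finset.mem_insert.1 hr with rfl | hr
    · exact hperm
    · exact hT.2 r (Finset.mem_of_mem_erase hr)
  · rw [Finset.inter_insert_of_notMem hq, Finset.inter_eq_right.2 (Finset.erase_subset _ _),
      Finset.card_erase_of_mem hp]
    omega

theorem permFlipJoined_of_reflTransGen (hT : IsPermissible m col T)
    (h : Relation.ReflTransGen (IsFlip m col) T T') : PermFlipJoined m col T T' := by
  induction h using Relation.ReflTransGen.head_induction_on with
  | refl => exact ⟨0, fun _ => T', rfl, rfl, fun _ => hT, fun i => i.elim0⟩
  | head hflip _ ih =>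
    obtain ⟨n, f, hf₀, hfn, hf, hcard⟩ := ih hflip.2.1
    refine ⟨n + 1, Fin.cons _ f, rfl, ?_, ?_, ?_⟩
    · rwa [← Fin.succ_last, Fin.cons_succ]
    · exact Fin.cases hT hf
    · refine Fin.cases ?_ fun i => ?_
      · simpa [hf₀] using hflip.2.2
      · simpa [← Fin.succ_castSucc] using hcard i

/-- If as long as some arc is not good, one such arc can be flipped to a good one, then a
triangulation all of whose arcs are good can be reached. -/
theorem exists_reflTransGen_forall {Inv : Finset (ℤ × ℤ) → Prop} {Good : ℤ × ℤ → Prop}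
    (step : ∀ T, IsPermissible m col T → Inv T → (∃ p ∈ T, ¬ Good p) →
      ∃ p ∈ T, ∃ q, ¬ Good p ∧ Good q ∧ q ∉ T.erase p ∧ Permitted m col q ∧
        IsNoncrossing m (insert q (T.erase p)) ∧ Inv (insert q (T.erase p)))
    (hT : IsPermissible m col T) (hInv : Inv T) :
    ∃ T', Relation.ReflTransGen (IsFlip m col) T T' ∧ IsPermissible m col T' ∧ Inv T' ∧
      ∀ p ∈ T', Good p := by
  classical
  induction hn : (T.filter fun p => ¬ Good p).card using Nat.strong_induction_on
    generalizing T with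
  | _ n ih =>
    by_cases hbad : ∃ p ∈ T, ¬ Good p
    · obtain ⟨p, hp, q, hpb, hqg, hq, hperm, hins, hInv'⟩ := step T hT hInv hbad
      have hqT : q ∉ T := fun h => hq (Finset.mem_erase.2 ⟨fun h' => hpb (h' ▸ hqg), h⟩)
      have hflip := isFlip_insert_erase hT hp hqT hins hperm
      have hlt : ((insert q (T.erase p)).filter fun p => ¬ Good p).card < n := by
        rw [← hn, Finset.filter_insert, if_neg (not_not.2 hqg), Finset.filter_erase]
        exact Finset.card_erase_lt_of_mem (Finset.mem_filter.2 ⟨hp, hpb⟩)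
      obtain ⟨T', hreach, h⟩ := ih _ hlt hflip.2.1 hInv' rfl
      exact ⟨T', hreach.head hflip, h⟩
    · push Not at hbad
      exact ⟨T, .refl, hT, hInv, hbad⟩

theorem lift_erase_iff : Lift m (T.erase p) c d ↔ canon m c d ≠ p ∧ Lift m T c d :=
  Finset.mem_erase

/-- After removing an arc, its apex shares its region with a second vertex. -/
theorem exists_second_apex (hT : IsPTriangulation m T) (hz : Innermost (Lift m T) z a b)
    (hcd : Lift m (T.erase (canon m a b)) c d) :
    ∃ w, w ≠ z ∧ Innermost (Lift m (T.erase (canon m a b))) w c d := by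
  have hcd' := lift_erase_iff.1 hcd
  obtain ⟨w, hw⟩ := hT.isNoncrossing.arcSystem.exists_apex hcd'.2
  refine ⟨w, ?_, hw.anti (fun e f h => (lift_erase_iff.1 h).2) hcd⟩
  rintro rfl
  obtain ⟨rfl, rfl⟩ := hz.unique hw
  exact hcd'.1 rfl

/-- The arc `p` does not pass strictly above any lift of the vertex `v`. -/
def Avoids (m : ℕ) (v : ℤ) (p : ℤ × ℤ) : Prop :=
  ∀ k : ℤ, ¬ (p.1 < v + k * m ∧ v + k * m < p.2)

theorem avoids_canon : Avoids m v (canon m a b) ↔ Avoids m v (a, b) := by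
  rw [canon_eq_shift]
  constructor
  · intro h k hk
    refine h (k - a / m) ?_
    simp only [sub_mul, neg_mul] at hk ⊢
    omega
  · intro h k hk
    refine h (k + a / m) ?_
    simp only [add_mul, neg_mul] at hk ⊢
    omega

theorem forall_avoids_iff (hT : IsNoncrossing m T) :
    (∀ p ∈ T, Avoids m v p) ↔ ¬ Enclosed (Lift m T) v := by
  constructor
  · rintro h ⟨a, b, hab, h₁, h₂⟩
    exact avoids_canon.1 (h _ hab) 0 (by simpa using ⟨h₁, h₂⟩)
  · intro h p hp k hk
    exact h ((hT.arcSystem.enclosed_shift_iff k).1 ⟨p.1, p.2, lift_of_mem hT hp, hk⟩)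

theorem avoids_of_left (h : b ≤ v + m) : Avoids m v (v, b) := by
  rintro k ⟨h₁, h₂⟩
  have := eq_zero_of_mul_lt (k := k) (n := m) (by dsimp only at h₁; omega)
    (by dsimp only at h₂; omega)
  subst this
  simp at h₁

theorem avoids_of_right (h : v ≤ a + m) : Avoids m v (a, v) := by
  rintro k ⟨h₁, h₂⟩
  have := eq_zero_of_mul_lt (k := k) (n := m) (by dsimp only at h₁; omega)
    (by dsimp only at h₂; omega)
  subst this
  simp at h₂

/-- Flips to arcs based at the blue vertex `v` clear all arcs passing strictly above `v`. -/
theorem exists_reflTransGen_not_enclosed (hm : 2 ≤ m) (hv : col v = true)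
    (hT : IsPermissible m col T) :
    ∃ T', Relation.ReflTransGen (IsFlip m col) T T' ∧ IsPermissible m col T' ∧
      ¬ Enclosed (Lift m T') v := by
  refine (exists_reflTransGen_forall (Inv := fun _ => True) (Good := Avoids m v)
    (fun T hT _ hbad => ?_) hT trivial).imp fun T' h =>
      ⟨h.1, h.2.1, (forall_avoids_iff h.2.1.1.isNoncrossing).1 h.2.2.2⟩
  have hnc := hT.1.isNoncrossing
  have henc : Enclosed (Lift m T) v := by
    by_contra h
    obtain ⟨p, hp, hpb⟩ := hbad
    exact hpb ((forall_avoids_iff hnc).2 h p hp)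
  obtain ⟨a, b, hab⟩ := hnc.arcSystem.exists_innermost henc
  have hbad' : ¬ Avoids m v (canon m a b) := fun h =>
    avoids_canon.1 h 0 (by simpa using ⟨hab.2.1, hab.2.2.1⟩)
  have hS := hnc.subset (Finset.erase_subset (canon m a b) T)
  refine ⟨canon m a b, hab.1, ?_⟩
  by_cases hvS : Enclosed (Lift m (T.erase (canon m a b))) v
  · obtain ⟨c, d, hcd⟩ := hS.arcSystem.exists_innermost hvS
    have hlen := hS.arcSystem.le_period hcd.1
    have := hcd.2.1
    have := hcd.2.2.1
    obtain ⟨w, hwv, hw⟩ := exists_second_apex hT.1 hab hcd.1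
    rcases lt_or_gt_of_ne hwv with hlt | hlt
    · obtain ⟨h₁, h₂⟩ := hS.insert_left hm hw hcd hlt
      exact ⟨_, hbad', avoids_canon.2 (avoids_of_right (by omega)), h₂,
        permitted_canon.2 (Or.inr hv), h₁, trivial⟩
    · obtain ⟨h₁, h₂⟩ := hS.insert_right hm hcd hw hlt
      exact ⟨_, hbad', avoids_canon.2 (avoids_of_left (by omega)), h₂,
        permitted_canon.2 (Or.inl hv), h₁, trivial⟩
  · refine ⟨canon m v (v + m), hbad', avoids_canon.2 (avoids_of_left le_rfl), fun hmem => ?_,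
      permitted_canon.2 (Or.inl hv), hS.insert_loop hm hvS, trivial⟩
    have hlen := hnc.arcSystem.le_period hab.1
    have := hnc.arcSystem.noncrossing hab.1 (Finset.mem_of_mem_erase hmem) hab.2.1 hab.2.2.1
    have := hab.2.1
    omega

/-- The arcs whose left end is the vertex `v`. -/
noncomputable def fan (m : ℕ) (v : ℤ) : Finset (ℤ × ℤ) :=
  (Finset.Icc 2 (m : ℤ)).image fun j => canon m v (v + j)

theorem card_fan_le : (fan m v).card ≤ m - 1 := by
  refine Finset.card_image_le.trans ?_
  simp only [Int.card_Icc]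
  omega

theorem canon_mem_fan (h₁ : a + 2 ≤ b) (h₂ : b ≤ a + m) (k : ℤ) (hk : a = v + k * m) :
    canon m a b ∈ fan m v := by
  refine Finset.mem_image.2 ⟨b - a, Finset.mem_Icc.2 (by omega), ?_⟩
  rw [← canon_shift k, ← hk]
  congr 1
  omega

theorem exists_of_canon_mem_fan (h : canon m a b ∈ fan m v) : ∃ k : ℤ, a = v + k * m := by
  obtain ⟨j, -, hj⟩ := Finset.mem_image.1 h
  obtain ⟨k, hk, -⟩ := exists_shift_of_canon_eq hj
  exact ⟨k, hk⟩

/-- Once no arc passes strictly above `v`, flips lead to the fan at `v`. -/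
theorem reflTransGen_fan_of_not_enclosed (hm : 2 ≤ m) (hv : col v = true)
    (hT : IsPermissible m col T) (hvT : ¬ Enclosed (Lift m T) v) :
    Relation.ReflTransGen (IsFlip m col) T (fan m v) := by
  suffices h : ∃ T', Relation.ReflTransGen (IsFlip m col) T T' ∧ IsPermissible m col T' ∧
      ¬ Enclosed (Lift m T') v ∧ ∀ p ∈ T', p ∈ fan m v by
    obtain ⟨T', hreach, hT', -, h⟩ := h
    rwa [← Finset.eq_of_subset_of_card_le h (by rw [hT'.1.1]; exact card_fan_le)]
  refine exists_reflTransGen_forall (Inv := fun T => ¬ Enclosed (Lift m T) v)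
    (Good := fun p => p ∈ fan m v) (fun T hT hvT hbad => ?_) hT hvT
  have hnc := hT.1.isNoncrossing
  have hP := hnc.arcSystem
  obtain ⟨p, hp, hmax⟩ := Finset.exists_max_image (T.filter fun p => p ∉ fan m v)
    (fun p => p.2 - p.1) (hbad.imp fun p hp => Finset.mem_filter.2 hp)
  rw [Finset.mem_filter] at hp
  obtain ⟨a, b⟩ := p
  obtain ⟨hpT, hpb⟩ := hp
  have hpc : canon m a b = (a, b) := canon_of_isPArc (hT.1.2.1 _ hpT)
  have hmax' : ∀ c d, Lift m T c d → b - a < d - c → canon m c d ∈ fan m v := by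
    intro c d hcd hlt
    by_contra hmem
    have := hmax _ (Finset.mem_filter.2 ⟨hcd, hmem⟩)
    simp only [canon] at this
    omega
  obtain ⟨z, hz⟩ := hP.exists_apex (lift_of_mem hnc hpT)
  dsimp only at hz
  rw [← hpc] at hpT hpb
  have hS := hnc.subset (Finset.erase_subset (canon m a b) T)
  have hloop : Lift m T v (v + m) := hT.1.lift_loop hm hvT
  have hzS : Enclosed (Lift m (T.erase (canon m a b))) z := by
    obtain ⟨k, hk⟩ := exists_mem_Ico_shift hm (z - v)
    rw [Finset.mem_Ico] at hk
    have hne : z - v + k * m ≠ 0 := fun h => hvT ((hP.enclosed_shift_iff (-k)).1 (by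
      rw [neg_mul, show v + -(k * m) = z by omega]
      exact hz.enclosed))
    have hmem : canon m v (v + m) ≠ canon m a b := fun h =>
      hpb (h ▸ canon_mem_fan (by omega) le_rfl 0 (by simp))
    refine ⟨v + -k * m, v + m + -k * m, hS.arcSystem.shift _ (lift_erase_iff.2 ⟨hmem, hloop⟩),
      ?_, ?_⟩ <;> rw [neg_mul] <;> omega
  obtain ⟨c, d, hcd⟩ := hS.arcSystem.exists_innermost hzS
  have hcdT := (lift_erase_iff.1 hcd.1).2
  obtain ⟨k, hk⟩ : ∃ k : ℤ, c = v + k * m := by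
    refine exists_of_canon_mem_fan (hmax' c d hcdT ?_)
    have := hz.2.2.2 c d hcdT hcd.2.1 hcd.2.2.1
    have hne : ¬ (c = a ∧ d = b) := fun h => (lift_erase_iff.1 hcd.1).1 (by rw [h.1, h.2])
    omega
  obtain ⟨w, hwz, hw⟩ := exists_second_apex hT.1 hz hcd.1
  obtain ⟨x, y, hxy, hx, hy⟩ : ∃ x y, x < y ∧ Innermost (Lift m (T.erase (canon m a b))) x c d ∧
      Innermost (Lift m (T.erase (canon m a b))) y c d := by
    rcases lt_or_gt_of_ne hwz with hlt | hlt
    · exact ⟨w, z, hlt, hw, hcd⟩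
    · exact ⟨z, w, hlt, hcd, hw⟩
  obtain ⟨h₁, h₂⟩ := hS.insert_left hm hx hy hxy
  have hlen := hP.le_period hcdT
  have hyd := hy.2.2.1
  refine ⟨canon m a b, hpT, canon m c y, hpb,
    canon_mem_fan (by have := hx.2.1; omega) (by omega) k hk, h₂,
    permitted_canon.2 (Or.inl (by rw [hk]; simpa using hv)), h₁, ?_⟩
  rw [← forall_avoids_iff h₁]
  intro p hp
  rcases Finset.mem_insert.1 hp with rfl | hp
  · rw [avoids_canon]
    intro l hl
    have := avoids_canon.1 ((forall_avoids_iff hnc).2 hvT _ hcdT) l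
    dsimp only at this hl
    omega
  · exact (forall_avoids_iff hnc).2 hvT p (Finset.mem_of_mem_erase hp)

theorem reflTransGen_fan (hm : 2 ≤ m) (hv : col v = true) (hT : IsPermissible m col T) :
    Relation.ReflTransGen (IsFlip m col) T (fan m v) := by
  obtain ⟨T', hreach, hT', hvT'⟩ := exists_reflTransGen_not_enclosed hm hv hT
  exact hreach.trans (reflTransGen_fan_of_not_enclosed hm hv hT' hvT')

end Flip

/-- For any non-trivial bicolouring of `P*_m` (`m ≥ 2`), the complex
of permitted arcs is an `(m-2)`-pseudo-manifold with boundary: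
(i) every set of pairwise non-crossing permitted arcs is contained in a set of `m - 1`
pairwise non-crossing permitted arcs (a permissible triangulation);
(ii) any two permissible triangulations are joined by a sequence of permissible
triangulations in which consecutive ones share exactly `m - 2` arcs;
(iii) every set of `m - 2` pairwise non-crossing permitted arcs is contained in at most
two permissible triangulations. -/
theorem permitted_complex_pseudomanifold (m : ℕ) (hm : 2 ≤ m) (c : ZMod m → Bool)
    (hc : IsNontrivialBicolouring m c) :
    (∀ S : Finset (ℤ × ℤ),
        (∀ p ∈ S, IsPArc m p ∧ Permitted m c p) →
        (∀ p ∈ S, ∀ q ∈ S, p ≠ q → ¬ PCross m p q) →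
        ∃ T : Finset (ℤ × ℤ), IsPermissible m c T ∧ S ⊆ T) ∧
    (∀ T₁ T₂ : Finset (ℤ × ℤ),
        IsPermissible m c T₁ → IsPermissible m c T₂ → PermFlipJoined m c T₁ T₂) ∧
    (∀ S : Finset (ℤ × ℤ), S.card = m - 2 →
        (∀ p ∈ S, IsPArc m p ∧ Permitted m c p) →
        (∀ p ∈ S, ∀ q ∈ S, p ≠ q → ¬ PCross m p q) →
        ∀ T₁ T₂ T₃ : Finset (ℤ × ℤ),
          IsPermissible m c T₁ → S ⊆ T₁ →
          IsPermissible m c T₂ → S ⊆ T₂ →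
          IsPermissible m c T₃ → S ⊆ T₃ →
          T₁ = T₂ ∨ T₁ = T₃ ∨ T₂ = T₃) := by
  obtain ⟨⟨hblue, -⟩, -⟩ := hc
  refine ⟨fun S hS hnc => ?_, fun T₁ T₂ h₁ h₂ => ?_,
    fun S hcard hS hnc T₁ T₂ T₃ h₁ hS₁ h₂ hS₂ h₃ hS₃ => ?_⟩
  · exact exists_isPermissible_superset hm hblue ⟨fun p hp => (hS p hp).1, hnc⟩
      fun p hp => (hS p hp).2
  · obtain ⟨v, hv⟩ := hblue
    obtain ⟨v, rfl⟩ := ZMod.intCast_surjective v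
    refine permFlipJoined_of_reflTransGen h₁ ((reflTransGen_fan hm hv h₁).trans ?_)
    have : Std.Symm (IsFlip m c) := ⟨fun _ _ => IsFlip.symm⟩
    exact Relation.ReflTransGen.stdSymm.symm _ _ (reflTransGen_fan hm hv h₂)
  · obtain ⟨q, r, h⟩ := exists_completions hm ⟨fun p hp => (hS p hp).1, hnc⟩ hcard
    have e₁ := h T₁ h₁.1 hS₁
    have e₂ := h T₂ h₂.1 hS₂
    have e₃ := h T₃ h₃.1 hS₃
    grind

end Punc
end

section
/- For any bicolouring of the once-punctured convex m-gon P*_m (m ≥ 2), every permissible triangulation of P*_m contains exactly one maximal arc, and the vertex at which this maximal arc is based is blue. -/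
/-!
Vertices of the once-punctured convex `m`-gon `P*_m` are identified with `ZMod m`.
An arc is an equivalence class `[(a,b)]` of pairs of integers with
`a < b ≤ a + m` and `b - a ≥ 2`, modulo `(a,b) ∼ (a+m, b+m)`.  Each class has a unique
representative with `0 ≤ a < m`; we identify arcs with these canonical representatives,
i.e. with pairs `p : ℤ × ℤ` satisfying `IsPArc m p` below.
Blue is encoded by the Boolean value `true`, red by `false`.
-/

namespace Punc

/-- `(x, y)` is an integer pair representing an arc of `T`. -/
def Represents (m : ℕ) (T : Finset (ℤ × ℤ)) (x y : ℤ) : Prop :=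
  ∃ k : ℤ, (x + k * m, y + k * m) ∈ T

lemma Represents.of_mem {m : ℕ} {T : Finset (ℤ × ℤ)} {p : ℤ × ℤ} (hp : p ∈ T) :
    Represents m T p.1 p.2 :=
  ⟨0, by simpa using hp⟩

lemma Represents.shift {m : ℕ} {T : Finset (ℤ × ℤ)} {x y : ℤ} (h : Represents m T x y) (j : ℤ) :
    Represents m T (x + j * m) (y + j * m) := by
  obtain ⟨k, hk⟩ := h
  refine ⟨k - j, ?_⟩
  convert hk using 2 <;> ring

lemma Represents.length {m : ℕ} {T : Finset (ℤ × ℤ)} (hT : ∀ p ∈ T, IsPArc m p) {x y : ℤ}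
    (h : Represents m T x y) : x + 2 ≤ y ∧ y ≤ x + m := by
  obtain ⟨k, hk⟩ := h
  obtain ⟨-, -, h₁, h₂⟩ := hT _ hk
  dsimp only at h₁ h₂
  constructor <;> linarith

lemma not_pCross_self {m : ℕ} {p : ℤ × ℤ} (hp : IsPArc m p) : ¬ PCross m p p := by
  obtain ⟨-, -, -, h⟩ := hp
  rintro ⟨k, ⟨h₁, h₂, h₃⟩ | ⟨h₁, h₂, h₃⟩⟩
  · have hk : k ≤ -1 := by
      by_contra! hk
      nlinarith
    nlinarith
  · have hk : 1 ≤ k := by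
      by_contra! hk
      nlinarith
    nlinarith

lemma Represents.not_cross {m : ℕ} {T : Finset (ℤ × ℤ)} (hT : IsPTriangulation m T)
    {x y z w : ℤ} (h : Represents m T x y) (h' : Represents m T z w) :
    ¬ (x < z ∧ z < y ∧ y < w) := by
  rintro ⟨h₁, h₂, h₃⟩
  obtain ⟨k, hk⟩ := h
  obtain ⟨l, hl⟩ := h'
  have hcross : PCross m (x + k * m, y + k * m) (z + l * m, w + l * m) :=
    ⟨l - k, Or.inl (by refine ⟨?_, ?_, ?_⟩ <;> dsimp only <;> linarith)⟩
  by_cases heq : ((x + k * m, y + k * m) : ℤ × ℤ) = (z + l * m, w + l * m)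
  · rw [← heq] at hcross
    exact not_pCross_self (hT.2.1 _ hk) hcross
  · exact hT.2.2 _ hk _ hl heq hcross

/-- In a laminar family of integer intervals, every interval has an interior point for which it
is the smallest interval of the family around that point. -/
lemma exists_private_point {L : ℤ → ℤ → Prop} (hlen : ∀ {x y}, L x y → x + 2 ≤ y)
    (hL : ∀ {x y z w}, L x y → L z w → ¬ (x < z ∧ z < y ∧ y < w)) {a b : ℤ} (hab : L a b) :
    ∃ v, a < v ∧ v < b ∧ ∀ c d, L c d → c < v → v < d → c ≤ a ∧ b ≤ d := by
  have hlab := hlen hab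
  by_cases hchild : ∃ n x y, L x y ∧ a ≤ x ∧ y ≤ b ∧ (a < x ∨ y < b) ∧ n = y - x
  · obtain ⟨n, ⟨x, y, hxy, hax, hyb, hne, hn⟩, hmax⟩ :=
      Int.exists_greatest_of_bdd ⟨b - a, by rintro _ ⟨x, y, -, _, _, -, rfl⟩; omega⟩ hchild
    have hlxy := hlen hxy
    have key : ∀ c d, L c d → a ≤ c → d ≤ b → (a < c ∨ d < b) → d - c ≤ y - x :=
      fun c d h h₁ h₂ h₃ ↦ hn ▸ hmax _ ⟨c, d, h, h₁, h₂, h₃, rfl⟩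
    obtain ⟨v, hav, hvb, hv⟩ : ∃ v, a < v ∧ v < b ∧ (v = x ∨ v = y) := by
      rcases hne with h | h
      · exact ⟨x, by omega, by omega, Or.inl rfl⟩
      · exact ⟨y, by omega, by omega, Or.inr rfl⟩
    refine ⟨v, hav, hvb, fun c d hcd hcv hvd ↦ ?_⟩
    have := key c d hcd
    have := hL hab hcd
    have := hL hcd hab
    have := hL hxy hcd
    have := hL hcd hxy
    omega
  · refine ⟨a + 1, by omega, by omega, fun c d hcd hcv hvd ↦ ?_⟩
    have : ¬ (a ≤ c ∧ d ≤ b ∧ (a < c ∨ d < b)) :=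
      fun ⟨h₁, h₂, h₃⟩ ↦ hchild ⟨_, c, d, hcd, h₁, h₂, h₃, rfl⟩
    have := hL hab hcd
    have := hL hcd hab
    omega

lemma exists_eq_add_mul_of_cast_eq {m : ℕ} {x y : ℤ} (h : (x : ZMod m) = y) :
    ∃ k : ℤ, y = x + k * m := by
  obtain ⟨k, hk⟩ := (ZMod.intCast_eq_intCast_iff_dvd_sub x y m).1 h
  exact ⟨k, by linarith [mul_comm (m : ℤ) k]⟩

/-- Two arcs with a common shift of one another coincide. -/
lemma IsPArc.eq_of_shift {m : ℕ} {p q : ℤ × ℤ} (hp : IsPArc m p) (hq : IsPArc m q) {k : ℤ}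
    (h₁ : q.1 = p.1 + k * m) (h₂ : q.2 = p.2 + k * m) : p = q := by
  have hk : k = 0 := by
    obtain ⟨hp₁, hp₂, -⟩ := hp
    obtain ⟨hq₁, hq₂, -⟩ := hq
    apply le_antisymm <;> by_contra! hk <;> nlinarith
  subst hk
  exact Prod.ext (by simp [h₁]) (by simp [h₂])

lemma IsMaximalArc.eq {m : ℕ} {T : Finset (ℤ × ℤ)} (hT : IsPTriangulation m T) {p q : ℤ × ℤ}
    (hp : p ∈ T) (hq : q ∈ T) (hpm : IsMaximalArc m p) (hqm : IsMaximalArc m q) : p = q := by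
  obtain ⟨⟨hp₁, hp₂, -⟩, hp₃⟩ := hpm
  obtain ⟨⟨hq₁, hq₂, -⟩, hq₃⟩ := hqm
  have h := (Represents.of_mem hp).not_cross hT (Represents.of_mem hq)
  have h' := (Represents.of_mem hq).not_cross hT (Represents.of_mem hp)
  exact Prod.ext (by omega) (by omega)

lemma IsPTriangulation.exists_isMaximalArc {m : ℕ} (hm : 2 ≤ m) {T : Finset (ℤ × ℤ)}
    (hT : IsPTriangulation m T) : ∃ p ∈ T, IsMaximalArc m p := by
  have : NeZero m := ⟨by omega⟩
  have hcard := hT.1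
  obtain ⟨r, hr, hrmax⟩ := T.exists_max_image (fun p ↦ p.2 - p.1)
    (Finset.card_pos.1 (by omega))
  refine ⟨r, hr, hT.2.1 r hr, ?_⟩
  by_contra hlt
  have hrlen := (Represents.of_mem hr).length hT.2.1
  have hrmax' : ∀ {x y}, Represents m T x y → y - x ≤ r.2 - r.1 := by
    rintro x y ⟨k, hk⟩
    have := hrmax _ hk
    dsimp only at this
    linarith
  choose! v hv₁ hv₂ hv using fun p (hp : p ∈ T) ↦
    exists_private_point (fun h ↦ (Represents.length hT.2.1 h).1)
      (Represents.not_cross hT) (Represents.of_mem hp)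
  have hinj : Set.InjOn (fun p ↦ (v p : ZMod m)) T := by
    intro p hp q hq h
    obtain ⟨k, hk⟩ := exists_eq_add_mul_of_cast_eq h
    have h₁ := hv q hq _ _ ((Represents.of_mem hp).shift k)
      (by linarith [hv₁ p hp]) (by linarith [hv₂ p hp])
    have h₂ := hv p hp _ _ ((Represents.of_mem hq).shift (-k))
      (by linarith [hv₁ q hq]) (by linarith [hv₂ q hq])
    exact (hT.2.1 p hp).eq_of_shift (hT.2.1 q hq) (k := k) (by linarith) (by linarith)
  have hsub : T.image (fun p ↦ (v p : ZMod m)) ⊆ {(r.1 : ZMod m), (r.2 : ZMod m)}ᶜ := by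
    intro u hu
    obtain ⟨p, hp, rfl⟩ := Finset.mem_image.1 hu
    simp only [Finset.mem_compl, Finset.mem_insert, Finset.mem_singleton]
    have hp₁ := hv₁ p hp
    have hp₂ := hv₂ p hp
    rintro (h | h) <;> obtain ⟨k, hk⟩ := exists_eq_add_mul_of_cast_eq h <;>
    · have hrep := (Represents.of_mem (m := m) hp).shift k
      have := hrmax' hrep
      have := hrep.not_cross hT (Represents.of_mem hr)
      have := (Represents.of_mem hr).not_cross hT hrep
      omega
  have hne : (r.1 : ZMod m) ≠ (r.2 : ZMod m) := by
    intro h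
    have := Int.le_of_dvd (by omega) ((ZMod.intCast_eq_intCast_iff_dvd_sub _ _ m).1 h)
    omega
  have hle := Finset.card_le_card hsub
  rw [Finset.card_image_of_injOn hinj, Finset.card_compl, ZMod.card, Finset.card_pair hne] at hle
  omega

/-- For any bicolouring of `P*_m` (`m ≥ 2`), every permissible
triangulation contains exactly one maximal arc, and the vertex at which this maximal arc
is based is blue. -/
theorem permissible_unique_maximal_arc_blue (m : ℕ) (hm : 2 ≤ m) (c : ZMod m → Bool)
    (hc : IsBicolouring m c)
    (T : Finset (ℤ × ℤ)) (hT : IsPermissible m c T) :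
    (∃! p : ℤ × ℤ, p ∈ T ∧ IsMaximalArc m p) ∧
      ∀ p ∈ T, IsMaximalArc m p → c (p.1 : ZMod m) = true := by
  obtain ⟨hT, hperm⟩ := hT
  refine ⟨?_, fun p hp hpm ↦ ?_⟩
  · obtain ⟨p, hp, hpm⟩ := hT.exists_isMaximalArc hm
    exact ⟨p, ⟨hp, hpm⟩, fun q hq ↦ hq.2.eq hT hq.1 hp hpm⟩
  · have hend : (p.2 : ZMod m) = p.1 := by
      rw [show p.2 = p.1 + (m : ℤ) by linarith [hpm.2]]
      simp
    simpa [Permitted, hend] using hperm p hp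

end Punc
end
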